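/- Let G(x,λ,α,β) = x³ + λ(λ − x) + α + βx and let β < 1/48, β ≠ 0, with B = √(1 − 48β) > 0. At the point x = (1 + B)/12, λ = (1 + B)/24, α = (1 + B − 24β(3 + 2B))/864 one has G = 0, ∂G/∂x = 0, ∂G/∂λ = 0, and the determinant of the Hessian of G with respect to (x,λ) equals B > 0 while ∂²G/∂x² = (1 + B)/2 ≠ 0; hence this point is an isola point of P_TI. -/

import Mathlib

/-- The simplest universal unfolding `P_TI` of a non-symmetric pitchfork:
`G(x,λ,α,β) = x³ + λ(λ − x) + α + βx`. -/
noncomputable def G (x l a b : ℝ) : ℝ := x^3 + l*(l - x) + a + b*x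

/-- `∂G/∂x` -/
noncomputable def Gx (x l a b : ℝ) : ℝ := deriv (fun t => G t l a b) x
/-- `∂G/∂λ` -/
noncomputable def Gl (x l a b : ℝ) : ℝ := deriv (fun t => G x t a b) l
/-- `∂²G/∂x²` -/
noncomputable def Gxx (x l a b : ℝ) : ℝ := deriv (fun t => Gx t l a b) x
/-- `∂²G/∂x∂λ` -/
noncomputable def Gxl (x l a b : ℝ) : ℝ := deriv (fun t => Gx x t a b) l
/-- `∂²G/∂λ∂x` -/
noncomputable def Glx (x l a b : ℝ) : ℝ := deriv (fun t => Gl t l a b) x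
/-- `∂²G/∂λ²` -/
noncomputable def Gll (x l a b : ℝ) : ℝ := deriv (fun t => Gl x t a b) l
/-- `∂³G/∂x³` -/
noncomputable def Gxxx (x l a b : ℝ) : ℝ := deriv (fun t => Gxx t l a b) x
/-- Determinant of the Hessian of `G` with respect to `(x,λ)`. -/
noncomputable def detH (x l a b : ℝ) : ℝ :=
  Gxx x l a b * Gll x l a b - Gxl x l a b * Glx x l a b

lemma Gx_eq (x l a b : ℝ) : Gx x l a b = 3 * x ^ 2 - l + b := by
  have h : HasDerivAt (fun t => G t l a b) (3 * x ^ 2 - l + b) x := by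
    unfold G
    refine HasDerivAt.congr_deriv (((((hasDerivAt_id x).pow 3).add (((hasDerivAt_id x).const_sub l).const_mul l)).add_const
      a).add ((hasDerivAt_id x).const_mul b)) ?_
    simp
    ring
  exact h.deriv

lemma Gl_eq (x l a b : ℝ) : Gl x l a b = 2 * l - x := by
  have h : HasDerivAt (fun t => G x t a b) (2 * l - x) l := by
    unfold G
    refine HasDerivAt.congr_deriv (((((hasDerivAt_id l).mul ((hasDerivAt_id l).sub_const x)).const_add
      (x ^ 3)).add_const a).add_const (b * x)) ?_
    simp
    ring
  exact h.deriv

lemma Gxx_eq (x l a b : ℝ) : Gxx x l a b = 6 * x := by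
  have h : HasDerivAt (fun t => Gx t l a b) (6 * x) x := by
    simp only [Gx_eq]
    refine HasDerivAt.congr_deriv (((((hasDerivAt_id x).pow 2).const_mul 3).sub_const l).add_const b) ?_
    simp
    ring
  exact h.deriv

lemma Gxl_eq (x l a b : ℝ) : Gxl x l a b = -1 := by
  have h : HasDerivAt (fun t => Gx x t a b) (-1) l := by
    simp only [Gx_eq]
    exact ((hasDerivAt_id l).const_sub (3 * x ^ 2)).add_const b
  exact h.deriv

lemma Glx_eq (x l a b : ℝ) : Glx x l a b = -1 := by
  have h : HasDerivAt (fun t => Gl t l a b) (-1) x := by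
    simp only [Gl_eq]
    exact (hasDerivAt_id x).const_sub (2 * l)
  exact h.deriv

lemma Gll_eq (x l a b : ℝ) : Gll x l a b = 2 := by
  have h : HasDerivAt (fun t => Gl x t a b) 2 l := by
    simp only [Gl_eq]
    simpa using ((hasDerivAt_id l).const_mul 2).sub_const x
  exact h.deriv

lemma detH_eq (x l a b : ℝ) : detH x l a b = 12 * x - 1 := by
  rw [detH, Gxx_eq, Gll_eq, Gxl_eq, Glx_eq]
  ring

/-- For `β < 1/48`, `β ≠ 0`, with `B = √(1 − 48β)`, the point
`x = (1+B)/12`, `λ = (1+B)/24`, `α = (1+B−24β(3+2B))/864` is an isola point of `P_TI`. -/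
theorem TI_isola_point (b : ℝ) (hb1 : b < 1/48) (hb0 : b ≠ 0)
    (B x l a : ℝ) (hB : B = Real.sqrt (1 - 48*b))
    (hx : x = (1 + B)/12) (hl : l = (1 + B)/24)
    (ha : a = (1 + B - 24*b*(3 + 2*B))/864) :
    B > 0 ∧
    G x l a b = 0 ∧ Gx x l a b = 0 ∧ Gl x l a b = 0 ∧
    detH x l a b = B ∧ detH x l a b > 0 ∧
    Gxx x l a b = (1 + B)/2 ∧ Gxx x l a b ≠ 0 := by
  have hpos : 0 < B := hB ▸ Real.sqrt_pos.mpr (by linarith)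
  have hsq : B ^ 2 = 1 - 48 * b := hB ▸ Real.sq_sqrt (by linarith)
  obtain rfl : b = (1 - B ^ 2) / 48 := by linarith
  have hdet : detH x l a ((1 - B ^ 2) / 48) = B := by rw [detH_eq, hx]; ring
  have hxx : Gxx x l a ((1 - B ^ 2) / 48) = (1 + B) / 2 := by rw [Gxx_eq, hx]; ring
  refine ⟨hpos, ?_, ?_, ?_, hdet, hpos.trans_eq hdet.symm, hxx, ?_⟩
  · rw [G, hx, hl, ha]; ring
  · rw [Gx_eq, hx, hl]; ring
  · rw [Gl_eq, hx, hl]; ring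
  · rw [hxx]; positivity
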